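/- Let g(x) := (x+1)·log₂(x+1) − x·log₂(x) for x > 0 and g(0) := 0, where log₂ denotes the base-2 logarithm. Fix κ > 1. Then, as n̄ tends to 0 from the right, the quantity (g(κ·(n̄+1) − 1) − g((κ−1)·(n̄+1))) / n̄ converges to log₂(κ/(κ−1)). -/

import Mathlib

/-- `g x = (x+1) log₂ (x+1) - x log₂ x`, with `g 0 = 0` (automatic from
Mathlib's convention `Real.log 0 = 0`). -/
noncomputable def g (x : ℝ) : ℝ :=
  (x + 1) * Real.logb 2 (x + 1) - x * Real.logb 2 x

/-- The derivative of `g` at a positive point is `log₂ (x + 1) - log₂ x`. -/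
theorem hasDerivAt_g {x : ℝ} (hx : 0 < x) :
    HasDerivAt g (Real.logb 2 (x + 1) - Real.logb 2 x) x := by
  have h₁ : HasDerivAt (fun y : ℝ => (y + 1) * Real.log (y + 1)) (Real.log (x + 1) + 1) x :=
    (Real.hasDerivAt_mul_log (by positivity : x + 1 ≠ 0)).comp_add_const x 1
  have h₂ := (h₁.sub (Real.hasDerivAt_mul_log hx.ne')).div_const (Real.log 2)
  refine (h₂.congr_deriv ?_).congr_of_eventuallyEq (Filter.Eventually.of_forall fun y => ?_)
  · simp only [Real.logb]
    ring
  · simp only [g, Real.logb, Pi.sub_apply]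
    ring

/-- Private/quantum capacity per unit cost of the ideal amplifier `A_κ^0`:
`(g (κ(n̄+1) - 1) - g ((κ-1)(n̄+1))) / n̄ → log₂ (κ/(κ-1))` as `n̄ → 0⁺`. -/
theorem ideal_amplifier_private_capacity_per_unit_cost (κ : ℝ) (hκ : 1 < κ) :
    Filter.Tendsto
      (fun n : ℝ => (g (κ * (n + 1) - 1) - g ((κ - 1) * (n + 1))) / n)
      (nhdsWithin 0 (Set.Ioi 0))
      (nhds (Real.logb 2 (κ / (κ - 1)))) := by
  have hpos : 0 < κ - 1 := sub_pos.mpr hκ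
  have hin : HasDerivAt (fun n : ℝ => κ * (n + 1) - 1) κ 0 := by
    simpa using (((hasDerivAt_id (0 : ℝ)).add_const 1).const_mul κ).sub_const 1
  have hout : HasDerivAt (fun n : ℝ => (κ - 1) * (n + 1)) (κ - 1) 0 := by
    simpa using ((hasDerivAt_id (0 : ℝ)).add_const 1).const_mul (κ - 1)
  have h₁ := HasDerivAt.comp_of_eq 0 (hasDerivAt_g hpos) hin (by ring)
  have h₂ := HasDerivAt.comp_of_eq 0 (hasDerivAt_g hpos) hout (by ring)
  have hlim := (h₁.sub h₂).tendsto_slope_zero_right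
  convert hlim using 2
  · simp [div_eq_inv_mul]
  · rw [Real.logb_div (by positivity) hpos.ne', sub_add_cancel]
    ring
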